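/- arXiv:2204.10288 — 2 statements merged into one kernel-verified Lean document; each statement's English description precedes it below -/
import Mathlib

section
/- Let a, b ∈ ℝ³ be unit vectors and let η = η_ab ∈ [0, π] be the angle between them. Then the correlation of Bell's local model equals the saw-tooth function: ∫_{S²} (−sign(⟨a, s⟩) · sign(⟨b, s⟩)) dμ(s) = −1 + (2/π)·η. -/
open MeasureTheory
open scoped RealInnerProductSpace ENNReal

/-- Euclidean 3-space. -/
noncomputable abbrev E3 := EuclideanSpace ℝ (Fin 3)

/-- The unit sphere `S²` in `ℝ³`. -/
noncomputable abbrev S2 := Metric.sphere (0 : E3) 1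

/-- The (unnormalized) rotation-invariant surface measure on `S²`. -/
noncomputable def sphereMeasure : Measure S2 := (volume : Measure E3).toSphere

/-- The uniform probability measure on `S²`: the rotation-invariant surface measure
normalized to total mass 1. -/
noncomputable def uniformS2 : Measure S2 := (sphereMeasure Set.univ)⁻¹ • sphereMeasure


lemma sphere_part (F : E3 → ℝ) (hF : ∀ (r : ℝ) (x : E3), 0 < r → F (r • x) = F x) :
    ∫ x : E3, F x * Real.exp (-‖x‖^2) =
     (∫ s : S2, F s ∂((volume : Measure E3).toSphere)) *
       ∫ r : Set.Ioi (0:ℝ), Real.exp (-(r:ℝ)^2) ∂(Measure.volumeIoiPow 2) := by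
  have h := (Measure.measurePreserving_homeomorphUnitSphereProd (volume : Measure E3))
  have hd : Module.finrank ℝ E3 - 1 = 2 := by simp
  rw [hd] at h
  rw [← integral_prod_mul (fun s : S2 => F s) (fun r : Set.Ioi (0:ℝ) => Real.exp (-(r:ℝ)^2)),
    ← h.integral_comp (Homeomorph.measurableEmbedding _)]
  have h0 : ∫ x : E3, F x * Real.exp (-‖x‖^2) = ∫ x in ({0}ᶜ : Set E3), F x * Real.exp (-‖x‖^2) := by
    rw [restrict_compl_singleton]
  rw [h0, ← integral_subtype_comap (measurableSet_singleton _).compl]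
  congr 1
  ext x
  have hx : (x : E3) ≠ 0 := x.2
  have hp : 0 < ‖(x:E3)‖ := norm_pos_iff.2 hx
  simp [hF _ _ (inv_pos.2 hp)]

lemma plane_part (h : ℝ × ℝ → ℝ) (hh : ∀ (r : ℝ) (p : ℝ × ℝ), 0 < r → h (r * p.1, r * p.2) = h p) :
    ∫ p : ℝ × ℝ, h p * Real.exp (-(p.1^2 + p.2^2)) =
     (∫ r in Set.Ioi (0:ℝ), r * Real.exp (-r^2)) *
      ∫ t in Set.Ioo (-Real.pi) Real.pi, h (Real.cos t, Real.sin t) := by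
  rw [← setIntegral_prod_mul, ← integral_comp_polarCoord_symm]
  refine setIntegral_congr_fun (measurableSet_Ioi.prod measurableSet_Ioo) ?_
  rintro ⟨r, t⟩ ⟨hr, ht⟩
  have hr : 0 < r := hr
  have e : (r * Real.cos t)^2 + (r * Real.sin t)^2 = r^2 := by
    have := Real.sin_sq_add_cos_sq t
    linear_combination r^2 * this
  simp only [polarCoord_symm_apply, smul_eq_mul, e, hh r (Real.cos t, Real.sin t) hr]
  ring

lemma basis_part (e : OrthonormalBasis (Fin 3) ℝ E3) (h : ℝ × ℝ → ℝ) :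
    ∫ x : E3, h (⟪e 0, x⟫, ⟪e 1, x⟫) * Real.exp (-‖x‖^2) =
     (∫ z : ℝ, Real.exp (-z^2)) * ∫ p : ℝ × ℝ, h p * Real.exp (-(p.1^2 + p.2^2)) := by
  rw [← integral_prod_mul]
  have m1 := e.measurePreserving_measurableEquiv
  have m2 := EuclideanSpace.volume_preserving_symm_measurableEquiv_toLp (Fin 3)
  have m3 := volume_preserving_piFinSuccAbove (fun _ : Fin 3 => ℝ) 2
  have m4 : MeasurePreserving (MeasurableEquiv.prodCongr (MeasurableEquiv.refl ℝ) (MeasurableEquiv.finTwoArrow (α := ℝ))) (volume : Measure (ℝ × (Fin 2 → ℝ))) (volume : Measure (ℝ × ℝ × ℝ)) :=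
    (MeasurePreserving.id (volume : Measure ℝ)).prod (volume_preserving_finTwoArrow ℝ)
  have m := ((m1.trans m2).trans m3).trans m4
  rw [← Measure.volume_eq_prod, ← m.integral_comp']
  congr 1
  ext x
  have n : ‖x‖^2 = ⟪e 0, x⟫^2 + ⟪e 1, x⟫^2 + ⟪e 2, x⟫^2 := by
    rw [← e.sum_sq_norm_inner_right x]
    simp [Fin.sum_univ_three]
  have hx : (((e.measurableEquiv.trans (MeasurableEquiv.toLp 2 (Fin 3 → ℝ)).symm).trans (MeasurableEquiv.piFinSuccAbove (fun _ : Fin 3 => ℝ) 2)).trans (MeasurableEquiv.prodCongr (MeasurableEquiv.refl ℝ) (MeasurableEquiv.finTwoArrow (α := ℝ)))) x = (⟪e 2, x⟫, ⟪e 0, x⟫, ⟪e 1, x⟫) := by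
    rw [← e.repr_apply_apply, ← e.repr_apply_apply, ← e.repr_apply_apply]
    rfl
  erw [hx]
  rw [n, mul_left_comm, ← Real.exp_add]
  congr 2
  ring

lemma P_ne : (∫ r in Set.Ioi (0:ℝ), r * Real.exp (-r^2)) ≠ 0 := by
  have := integral_rpow_mul_exp_neg_rpow (p := 2) (q := 1) (by norm_num) (by norm_num)
  norm_num at this
  rw [this]; norm_num

lemma Z_ne : (∫ z : ℝ, Real.exp (-z^2)) ≠ 0 := by
  have := integral_gaussian 1
  norm_num at this
  rw [this]; positivity

lemma exists_basis (a b : E3) (ha : ‖a‖ = 1) (hb : ‖b‖ = 1) :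
    ∃ e : OrthonormalBasis (Fin 3) ℝ E3, e 0 = a ∧
      b = Real.cos (InnerProductGeometry.angle a b) • e 0 + Real.sin (InnerProductGeometry.angle a b) • e 1 := by
  set η := InnerProductGeometry.angle a b with hη
  have hc : Real.cos η = ⟪a, b⟫ := by
    rw [hη, InnerProductGeometry.cos_angle, ha, hb]; simp
  have haa : ⟪a, a⟫ = 1 := by rw [real_inner_self_eq_norm_sq, ha]; norm_num
  have hbb : ⟪b, b⟫ = 1 := by rw [real_inner_self_eq_norm_sq, hb]; norm_num
  have hw : ‖b - Real.cos η • a‖^2 = Real.sin η ^2 := by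
    rw [← real_inner_self_eq_norm_sq]
    simp only [inner_sub_left, inner_sub_right, inner_smul_left, inner_smul_right, haa, hbb, real_inner_comm a b, ← hc]
    have := Real.sin_sq_add_cos_sq η
    simp
    linear_combination -this
  have hcard : Module.finrank ℝ E3 = Fintype.card (Fin 3) := by simp
  by_cases hs : Real.sin η = 0
  · have hv : Orthonormal ℝ (({0} : Set (Fin 3)).domRestrict (fun _ => a)) := by
      constructor
      · intro i; simp [Set.domRestrict, ha]
      · intro i j hij
        exact (hij (Subsingleton.elim _ _)).elim
    obtain ⟨e, he⟩ := hv.exists_orthonormalBasis_extension_of_card_eq hcard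
    have h0 := he 0 (by simp)
    refine ⟨e, h0, ?_⟩
    rw [hs] at hw ⊢
    have : b - Real.cos η • a = 0 := by simpa using hw
    rw [h0, zero_smul, add_zero]
    exact sub_eq_zero.1 this
  · set v := (Real.sin η)⁻¹ • (b - Real.cos η • a) with hvd
    have hav : ⟪a, v⟫ = 0 := by
      rw [hvd, inner_smul_right, inner_sub_right, inner_smul_right, haa, hc]; simp
    have hvn : ‖v‖ = 1 := by
      have : ‖v‖^2 = 1 := by
        rw [hvd, norm_smul, mul_pow, hw]
        simp [hs]
      nlinarith [norm_nonneg v]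
    have hv : Orthonormal ℝ (({0, 1} : Set (Fin 3)).domRestrict ![a, v, 0]) := by
      constructor
      · rintro ⟨i, rfl | rfl⟩ <;> simp [Set.domRestrict, ha, hvn]
      · rintro ⟨i, rfl | rfl⟩ ⟨j, rfl | rfl⟩ hij
        · exact (hij rfl).elim
        · simpa [Set.domRestrict] using hav
        · simpa [Set.domRestrict, real_inner_comm] using hav
        · exact (hij rfl).elim
    obtain ⟨e, he⟩ := hv.exists_orthonormalBasis_extension_of_card_eq hcard
    have h0 : e 0 = a := he 0 (by simp)
    have h1 : e 1 = v := he 1 (by simp)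
    refine ⟨e, h0, ?_⟩
    rw [h0, h1, hvd, smul_inv_smul₀ hs]
    abel

lemma sign_meas : Measurable Real.sign := by
  unfold Real.sign
  exact Measurable.ite measurableSet_Iio measurable_const (Measurable.ite measurableSet_Ioi measurable_const measurable_const)

lemma sign_abs (x : ℝ) : |Real.sign x| ≤ 1 := by
  rcases Real.sign_apply_eq x with h | h | h <;> simp [h]

lemma circle_part (η : ℝ) (h0 : 0 ≤ η) (h1 : η ≤ Real.pi) :
    ∫ t in Set.Ioo (-Real.pi) Real.pi,
      Real.sign (Real.cos t) * Real.sign (Real.cos (t - η)) = 2 * Real.pi - 4 * η := by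
  have hpi := Real.pi_pos
  set f : ℝ → ℝ := fun t => Real.sign (Real.cos t) * Real.sign (Real.cos (t - η)) with hf
  have hm : Measurable f := 
    (sign_meas.comp Real.measurable_cos).mul (sign_meas.comp (Real.measurable_cos.comp (measurable_id.sub_const η)))
  have hi : ∀ t₁ t₂, IntervalIntegrable f volume t₁ t₂ := by
    intro t₁ t₂
    refine (intervalIntegrable_const (c := (1:ℝ))).mono_fun hm.aestronglyMeasurable ?_
    refine Filter.Eventually.of_forall fun t => ?_
    simp only [hf, norm_mul, Real.norm_eq_abs, abs_one]
    exact mul_le_one₀ (sign_abs _) (abs_nonneg _) (sign_abs _)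
  have hper : Function.Periodic f Real.pi := by
    intro t
    simp only [hf]
    rw [show t + Real.pi - η = (t - η) + Real.pi by ring, Real.cos_add_pi, Real.cos_add_pi, Real.sign_neg, Real.sign_neg]
    ring
  have e1 := hper.intervalIntegral_add_zsmul_eq 2 (-Real.pi) hi
  rw [hper.intervalIntegral_add_eq (-Real.pi) (-(Real.pi/2))] at e1
  rw [← integral_Ioc_eq_integral_Ioo, ← intervalIntegral.integral_of_le (by linarith)]
  have e2 : -Real.pi + (2:ℤ) • Real.pi = Real.pi := by simp; ring
  rw [e2] at e1
  rw [e1, ← intervalIntegral.integral_add_adjacent_intervals (hi _ (η - Real.pi/2)) (hi _ _)]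
  have i1 : ∫ t in (-(Real.pi/2))..(η - Real.pi/2), f t = ∫ t in (-(Real.pi/2))..(η - Real.pi/2), (-1:ℝ) := by
    rw [intervalIntegral.integral_of_le (by linarith), intervalIntegral.integral_of_le (by linarith), integral_Ioc_eq_integral_Ioo, integral_Ioc_eq_integral_Ioo]
    refine setIntegral_congr_fun measurableSet_Ioo ?_
    rintro t ⟨ht1, ht2⟩
    have c1 : 0 < Real.cos t := Real.cos_pos_of_mem_Ioo ⟨by linarith, by linarith⟩
    have c2 : Real.cos (t - η) < 0 := by
      rw [← Real.cos_neg]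
      exact Real.cos_neg_of_pi_div_two_lt_of_lt (by linarith) (by linarith)
    simp [hf, Real.sign_of_pos c1, Real.sign_of_neg c2]
  have i2 : ∫ t in (η - Real.pi/2)..(-(Real.pi/2) + Real.pi), f t = ∫ t in (η - Real.pi/2)..(-(Real.pi/2) + Real.pi), (1:ℝ) := by
    rw [intervalIntegral.integral_of_le (by linarith), intervalIntegral.integral_of_le (by linarith), integral_Ioc_eq_integral_Ioo, integral_Ioc_eq_integral_Ioo]
    refine setIntegral_congr_fun measurableSet_Ioo ?_
    rintro t ⟨ht1, ht2⟩
    have c1 : 0 < Real.cos t := Real.cos_pos_of_mem_Ioo ⟨by linarith, by linarith⟩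
    have c2 : 0 < Real.cos (t - η) := Real.cos_pos_of_mem_Ioo ⟨by linarith, by linarith⟩
    simp [hf, Real.sign_of_pos c1, Real.sign_of_pos c2]
  rw [i1, i2]
  simp
  ring


lemma sign_mul_pos' (r x : ℝ) (hr : 0 < r) : Real.sign (r * x) = Real.sign x := by
  rcases lt_trichotomy x 0 with h | h | h
  · rw [Real.sign_of_neg h, Real.sign_of_neg (mul_neg_of_pos_of_neg hr h)]
  · simp [h]
  · rw [Real.sign_of_pos h, Real.sign_of_pos (mul_pos hr h)]

theorem bell_local_model_correlation (a b : E3) (ha : ‖a‖ = 1) (hb : ‖b‖ = 1) :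
    ∫ s : S2, (-(Real.sign ⟪a, (s : E3)⟫ * Real.sign ⟪b, (s : E3)⟫)) ∂uniformS2
      = -1 + (2 / Real.pi) * InnerProductGeometry.angle a b := by
  obtain ⟨e, he0, heb⟩ := exists_basis a b ha hb
  have hη0 := InnerProductGeometry.angle_nonneg a b
  have hη1 := InnerProductGeometry.angle_le_pi a b
  set η := InnerProductGeometry.angle a b
  have key : ∀ h : ℝ × ℝ → ℝ, (∀ (r : ℝ) (p : ℝ × ℝ), 0 < r → h (r * p.1, r * p.2) = h p) →
      (∫ s : S2, h (⟪e 0, (s : E3)⟫, ⟪e 1, (s : E3)⟫) ∂sphereMeasure) *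
       (∫ r : Set.Ioi (0:ℝ), Real.exp (-(r:ℝ)^2) ∂(Measure.volumeIoiPow 2)) =
      (∫ z : ℝ, Real.exp (-z^2)) * ((∫ r in Set.Ioi (0:ℝ), r * Real.exp (-r^2)) *
      ∫ t in Set.Ioo (-Real.pi) Real.pi, h (Real.cos t, Real.sin t)) := by
    intro h hh
    rw [← plane_part h hh, ← basis_part e h]
    refine (sphere_part (fun x => h (⟪e 0, x⟫, ⟪e 1, x⟫)) ?_).symm
    intro r x hr
    simp only [inner_smul_right]
    exact hh r (_, _) hr
  have k1 := key (fun _ => 1) (fun _ _ _ => rfl)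
  have k2 := key (fun p => Real.sign p.1 * Real.sign (Real.cos η * p.1 + Real.sin η * p.2)) (by
    intro r p hr
    simp only
    rw [show Real.cos η * (r * p.1) + Real.sin η * (r * p.2) = r * (Real.cos η * p.1 + Real.sin η * p.2) by ring, sign_mul_pos' _ _ hr, sign_mul_pos' _ _ hr])
  have hc := circle_part η hη0 hη1
  simp only [Real.cos_sub, mul_comm (Real.cos η), mul_comm (Real.sin η)] at hc k2
  simp only [hc] at k2
  have hpi := Real.pi_pos
  have hone : ∫ t in Set.Ioo (-Real.pi) Real.pi, (1:ℝ) = 2 * Real.pi := by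
    simp; rw [max_eq_left (by linarith)]; ring
  rw [hone] at k1
  have hZ := Z_ne
  have hP := P_ne
  have hS : ∫ s : S2, (1:ℝ) ∂sphereMeasure = sphereMeasure.real Set.univ := by simp
  rw [hS] at k1
  have hI : ∫ s : S2, (-(Real.sign ⟪a, (s : E3)⟫ * Real.sign ⟪b, (s : E3)⟫)) ∂uniformS2 =
     -((sphereMeasure.real Set.univ)⁻¹ * ∫ s : S2, Real.sign ⟪e 0, (s : E3)⟫ * Real.sign (⟪e 0, (s : E3)⟫ * Real.cos η + ⟪e 1, (s : E3)⟫ * Real.sin η) ∂sphereMeasure) := by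
    rw [integral_neg, uniformS2, integral_smul_measure]
    congr 1
    rw [ENNReal.toReal_inv, smul_eq_mul]
    congr 1
    congr 1
    ext s
    have : ⟪b, (s:E3)⟫ = ⟪e 0, (s : E3)⟫ * Real.cos η + ⟪e 1, (s : E3)⟫ * Real.sin η := by
      conv_lhs => rw [heb]
      rw [inner_add_left, real_inner_smul_left, real_inner_smul_left]; ring
    rw [this, he0]
  rw [hI]
  generalize (∫ s : S2, Real.sign ⟪e 0, (s : E3)⟫ * Real.sign (⟪e 0, (s : E3)⟫ * Real.cos η + ⟪e 1, (s : E3)⟫ * Real.sin η) ∂sphereMeasure) = I at k2 ⊢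
  generalize (∫ z : ℝ, Real.exp (-z^2)) = Z at *
  generalize (∫ r in Set.Ioi (0:ℝ), r * Real.exp (-r^2)) = P at *
  generalize (∫ r : Set.Ioi (0:ℝ), Real.exp (-(r:ℝ)^2) ∂(Measure.volumeIoiPow 2)) = R at *
  generalize sphereMeasure.real Set.univ = σ at *
  have hne : σ * R ≠ 0 := by rw [k1]; positivity
  have hσ := left_ne_zero_of_mul hne
  have hR := right_ne_zero_of_mul hne
  have : I * Real.pi = σ * (Real.pi - 2 * η) := by
    apply mul_right_cancel₀ hR
    linear_combination Real.pi * k2 - (Real.pi - 2 * η) * k1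
  field_simp
  linear_combination -this
end

section
/- Define the saw-tooth correlation E(a, b) := −1 + (2/π)·η_ab for unit vectors a, b ∈ ℝ³, where η_ab ∈ [0, π] is the angle between a and b. Then for all unit vectors a, a′, b, b′ ∈ ℝ³, |E(a, b) + E(a, b′) + E(a′, b) − E(a′, b′)| ≤ 2; i.e., the weak correlations of Bell's local model are incapable of exceeding the bound of 2 set by the Bell-CHSH inequality. -/
/-- The saw-tooth correlations `E(a, b) = -1 + (2/π) η_ab` of Bell's local model satisfy
the Bell-CHSH bound of `2` for all unit vectors `a, a', b, b'` in `ℝ³`. -/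
theorem sawtooth_satisfies_chsh (a a' b b' : EuclideanSpace ℝ (Fin 3))
    (ha : ‖a‖ = 1) (ha' : ‖a'‖ = 1) (hb : ‖b‖ = 1) (hb' : ‖b'‖ = 1) :
    |(-1 + (2 / Real.pi) * InnerProductGeometry.angle a b)
        + (-1 + (2 / Real.pi) * InnerProductGeometry.angle a b')
        + (-1 + (2 / Real.pi) * InnerProductGeometry.angle a' b)
        - (-1 + (2 / Real.pi) * InnerProductGeometry.angle a' b')| ≤ 2 := by
  have h1 := InnerProductGeometry.angle_le_angle_add_angle a' b b'
  have h2 := InnerProductGeometry.angle_le_angle_add_angle b a b'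
  have h3 := InnerProductGeometry.angle_le_angle_add_angle a' b' b
  have h4 := InnerProductGeometry.angle_le_angle_add_angle b' (-a) b
  rw [InnerProductGeometry.angle_neg_right, InnerProductGeometry.angle_neg_left,
    InnerProductGeometry.angle_comm b' a] at h4
  rw [InnerProductGeometry.angle_comm b a] at h2
  have hpi := Real.pi_pos
  generalize InnerProductGeometry.angle a b = x at *
  generalize InnerProductGeometry.angle a b' = y at *
  generalize InnerProductGeometry.angle a' b = z at *
  generalize InnerProductGeometry.angle a' b' = w at *
  have e : (-1 + (2 / Real.pi) * x) + (-1 + (2 / Real.pi) * y) + (-1 + (2 / Real.pi) * z)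
      - (-1 + (2 / Real.pi) * w) = -2 + 2 * ((x + y + z - w) / Real.pi) := by
    ring
  have l : 0 ≤ (x + y + z - w) / Real.pi := div_nonneg (by linarith) hpi.le
  have u : (x + y + z - w) / Real.pi ≤ 2 := by
    rw [div_le_iff₀ hpi]
    linarith
  rw [e, abs_le]
  constructor <;> linarith
end
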